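/- Dickson's theorem: if q ≠ 9 is an odd prime power or q = 2, and λ is a primitive element of GF(q) (a generator of the multiplicative group GF(q)^*), then SL(2,q) is generated by the matrices [[1,1],[0,1]] and [[1,0],[λ,1]]. -/

import Mathlib

open Matrix

namespace DicksonSL2

variable {F : Type*} [Field F]

/-- The upper unipotent matrix `[[1, x], [0, 1]]`. -/
def upper (x : F) : SpecialLinearGroup (Fin 2) F :=
  ⟨!![1, x; 0, 1], by simp [Matrix.det_fin_two_of]⟩

/-- The lower unipotent matrix `[[1, 0], [x, 1]]`. -/
def lower (x : F) : SpecialLinearGroup (Fin 2) F :=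
  ⟨!![1, 0; x, 1], by simp [Matrix.det_fin_two_of]⟩

lemma det_eq_one (g : SpecialLinearGroup (Fin 2) F) : g 0 0 * g 1 1 - g 0 1 * g 1 0 = 1 := by
  rw [← Matrix.det_fin_two]; exact g.2

lemma ext_entries {g h : SpecialLinearGroup (Fin 2) F} (h00 : g 0 0 = h 0 0)
    (h01 : g 0 1 = h 0 1) (h10 : g 1 0 = h 1 0) (h11 : g 1 1 = h 1 1) : g = h := by
  ext i j
  fin_cases i <;> fin_cases j <;> assumption

lemma mul_entry (g h : SpecialLinearGroup (Fin 2) F) (i j : Fin 2) :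
    (g * h) i j = g i 0 * h 0 j + g i 1 * h 1 j := by
  simp [Matrix.mul_apply, Fin.sum_univ_two]

lemma inv_entries (g : SpecialLinearGroup (Fin 2) F) :
    g⁻¹ 0 0 = g 1 1 ∧ g⁻¹ 0 1 = -g 0 1 ∧ g⁻¹ 1 0 = -g 1 0 ∧ g⁻¹ 1 1 = g 0 0 := by
  simp [SpecialLinearGroup.SL2_inv_expl]

lemma upper_entries (x : F) :
    upper x 0 0 = 1 ∧ upper x 0 1 = x ∧ upper x 1 0 = 0 ∧ upper x 1 1 = 1 := by
  simp [upper]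

lemma lower_entries (x : F) :
    lower x 0 0 = 1 ∧ lower x 0 1 = 0 ∧ lower x 1 0 = x ∧ lower x 1 1 = 1 := by
  simp [lower]

lemma upper_add (x y : F) : upper (x + y) = upper x * upper y := by
  apply ext_entries <;> simp [mul_entry, upper_entries, add_comm]

lemma upper_zero : upper (0 : F) = 1 := by
  apply ext_entries <;> simp [upper_entries]

lemma upper_neg (x : F) : upper (-x) = (upper x)⁻¹ := by
  rw [eq_inv_iff_mul_eq_one, ← upper_add, neg_add_cancel, upper_zero]

lemma conj_upper_entries (g : SpecialLinearGroup (Fin 2) F) (x : F) :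
    (g * upper x * g⁻¹) 0 0 = 1 - x * g 0 0 * g 1 0 ∧
    (g * upper x * g⁻¹) 0 1 = x * g 0 0 ^ 2 ∧
    (g * upper x * g⁻¹) 1 0 = -x * g 1 0 ^ 2 ∧
    (g * upper x * g⁻¹) 1 1 = 1 + x * g 0 0 * g 1 0 := by
  have hdet := det_eq_one g
  simp only [mul_entry, upper_entries, inv_entries]
  refine ⟨?_, ?_, ?_, ?_⟩
  · linear_combination hdet
  · ring
  · ring
  · linear_combination hdet

/-- The additive group of those `x` for which `[[1, x], [0, 1]]` lies in `G`. -/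
def upperParams (G : Subgroup (SpecialLinearGroup (Fin 2) F)) : AddSubgroup F where
  carrier := {x | upper x ∈ G}
  zero_mem' := by simp [upper_zero, G.one_mem]
  add_mem' := fun {x y} hx hy => by
    simpa only [Set.mem_ofPred_eq, upper_add] using G.mul_mem hx hy
  neg_mem' := fun {x} hx => by
    simpa only [Set.mem_ofPred_eq, upper_neg] using G.inv_mem hx

lemma mem_upperParams {G : Subgroup (SpecialLinearGroup (Fin 2) F)} {x : F} :
    x ∈ upperParams G ↔ upper x ∈ G := Iff.rfl

/-- A subgroup of `SL(2, F)` containing all upper unipotent matrices and one nontrivial lower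
unipotent matrix is the whole group. -/
lemma eq_top_of_forall_upper_mem {G : Subgroup (SpecialLinearGroup (Fin 2) F)} {l : F}
    (hl : l ≠ 0) (hlow : lower l ∈ G) (hup : ∀ x, upper x ∈ G) : G = ⊤ := by
  have hw : ∀ x, lower x ∈ G := by
    intro x
    set w := upper (-l⁻¹) * lower l * upper (-l⁻¹) with hw
    have hwG : w ∈ G := G.mul_mem (G.mul_mem (hup _) hlow) (hup _)
    have : lower x = w * upper (-x * l⁻¹ ^ 2) * w⁻¹ := by
      rw [eq_mul_inv_iff_mul_eq, hw]
      apply ext_entries <;> simp only [mul_entry, upper_entries, lower_entries] <;> field_simp <;>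
        ring
    rw [this]
    exact G.mul_mem (G.mul_mem hwG (hup _)) (G.inv_mem hwG)
  have key : ∀ g : SpecialLinearGroup (Fin 2) F, g 1 0 ≠ 0 → g ∈ G := by
    intro g hg
    have hdet := det_eq_one g
    have : g = upper ((g 0 0 - 1) / g 1 0) * lower (g 1 0) * upper ((g 1 1 - 1) / g 1 0) := by
      apply ext_entries <;> simp [mul_entry, upper_entries, lower_entries] <;> field_simp
      · ring
      · linear_combination -hdet
      · ring
    rw [this]
    exact G.mul_mem (G.mul_mem (hup _) (hw _)) (hup _)
  rw [eq_top_iff]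
  intro g _
  by_cases hg : g 1 0 = 0
  · have hdet := det_eq_one g
    have h0 : g 0 0 ≠ 0 := by
      intro h; simp [h, hg] at hdet
    have : lower 1 * g ∈ G := key _ (by simp [mul_entry, lower_entries, hg, h0])
    exact (G.mul_mem_cancel_left (hw 1)).1 this
  · exact key g hg

/-- An element of `p`-power order in `SL(2, F)`, where `F` has characteristic `p`, has trace `2`. -/
lemma trace_eq_two_of_pow_eq_one {p : ℕ} [Fact p.Prime] [CharP F p] {k : ℕ}
    {g : SpecialLinearGroup (Fin 2) F} (hg : g ^ p ^ k = 1) : g 0 0 + g 1 1 = 2 := by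
  have h1 : (g : Matrix (Fin 2) (Fin 2) F) ^ p ^ k = 1 := by
    simpa using congrArg (fun h : SpecialLinearGroup (Fin 2) F => h.1) hg
  have h2 : IsNilpotent ((g : Matrix (Fin 2) (Fin 2) F) - 1) :=
    ⟨p ^ k, by rw [sub_pow_char_pow_of_commute p _ (Commute.one_right _), h1, one_pow, sub_self]⟩
  have h3 := (Matrix.isNilpotent_trace_of_isNilpotent h2).eq_zero
  simp only [Matrix.trace_sub, Matrix.trace_fin_two, Matrix.trace_one, Fintype.card_fin] at h3
  push_cast at h3
  linear_combination h3

/-- By Sylow's theorem, a lower unipotent element of `G` is conjugate in `G` to an upper one. -/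
lemma exists_eq_neg_mul_sq [Finite F] {p : ℕ} [Fact p.Prime] [CharP F p]
    {G : Subgroup (SpecialLinearGroup (Fin 2) F)} {l : F} (hl : l ≠ 0)
    (hup : upper 1 ∈ G) (hlow : lower l ∈ G) :
    ∃ y ∈ upperParams G, ∃ c : F, l = -y * c ^ 2 := by
  have hpU : (upper (1 : F)) ^ p = 1 := by
    have : ∀ n : ℕ, upper (1 : F) ^ n = upper (n : F) := by
      intro n
      induction n with
      | zero => simp [upper_zero]
      | succ n ih => rw [pow_succ, ih, ← upper_add]; simp
    rw [this, CharP.cast_eq_zero, upper_zero]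
  have hpL : (lower l) ^ p = 1 := by
    have : ∀ n : ℕ, lower l ^ n = lower (n * l) := by
      intro n
      induction n with
      | zero => apply ext_entries <;> simp [lower_entries]
      | succ n ih =>
        rw [pow_succ, ih]
        apply ext_entries <;> simp [mul_entry, lower_entries]
        ring
    rw [this, CharP.cast_eq_zero, zero_mul]
    apply ext_entries <;> simp [lower_entries]
  have hzp : ∀ g : G, g ^ p = 1 → ∃ P : Sylow p G, g ∈ P := by
    intro g hg
    have hP : IsPGroup p (Subgroup.zpowers g) := by
      rintro ⟨a, ha⟩
      obtain ⟨n, rfl⟩ := Subgroup.mem_zpowers_iff.1 ha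
      refine ⟨1, Subtype.ext ?_⟩
      rw [pow_one, SubmonoidClass.coe_pow, ← zpow_natCast, zpow_comm, zpow_natCast, hg,
        _root_.one_zpow]
      rfl
    obtain ⟨P, hP⟩ := hP.exists_le_sylow
    exact ⟨P, hP (Subgroup.mem_zpowers g)⟩
  obtain ⟨P, hP⟩ := hzp ⟨upper 1, hup⟩ (Subtype.ext (by simpa using hpU))
  obtain ⟨R, hR⟩ := hzp ⟨lower l, hlow⟩ (Subtype.ext (by simpa using hpL))
  obtain ⟨g, rfl⟩ := MulAction.exists_smul_eq G R P
  have htrace : ∀ x ∈ g • R, (x : SpecialLinearGroup (Fin 2) F) 0 0 +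
      (x : SpecialLinearGroup (Fin 2) F) 1 1 = 2 := by
    intro x hx
    obtain ⟨k, hk⟩ := (g • R).2 ⟨x, hx⟩
    refine trace_eq_two_of_pow_eq_one (p := p) (k := k) ?_
    simpa using congrArg (fun z => ((z : G) : SpecialLinearGroup (Fin 2) F))
      (congrArg Subtype.val hk)
  obtain ⟨x, hx⟩ : ∃ x : G, x = g * ⟨lower l, hlow⟩ * g⁻¹ := ⟨_, rfl⟩
  have hxP : x ∈ g • R := by
    rw [hx]
    exact Subgroup.smul_mem_pointwise_smul _ (MulAut.conj g) _ hR
  have hx1 := htrace x hxP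
  have hx2 := htrace (x * ⟨upper 1, hup⟩) ((g • R).mul_mem hxP hP)
  simp only [Subgroup.coe_mul, mul_entry, upper_entries] at hx2
  have hx10 : (x : SpecialLinearGroup (Fin 2) F) 1 0 = 0 := by linear_combination hx2 - hx1
  have hdet := det_eq_one (x : SpecialLinearGroup (Fin 2) F)
  have hx00 : (x : SpecialLinearGroup (Fin 2) F) 0 0 = 1 := by
    have : ((x : SpecialLinearGroup (Fin 2) F) 0 0 - 1) ^ 2 = 0 := by
      rw [hx10] at hdet
      linear_combination (x : SpecialLinearGroup (Fin 2) F) 0 0 * hx1 - hdet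
    exact sub_eq_zero.1 (pow_eq_zero_iff two_ne_zero |>.1 this)
  have hx11 : (x : SpecialLinearGroup (Fin 2) F) 1 1 = 1 := by
    linear_combination hx1 - hx00
  have hxu : (x : SpecialLinearGroup (Fin 2) F) =
      upper ((x : SpecialLinearGroup (Fin 2) F) 0 1) := by
    apply ext_entries <;> simp [upper_entries, hx00, hx10, hx11]
  set y := (x : SpecialLinearGroup (Fin 2) F) 0 1
  refine ⟨y, mem_upperParams.2 (hxu ▸ x.2), (g : SpecialLinearGroup (Fin 2) F) 1 0, ?_⟩
  have hcomm : (g : SpecialLinearGroup (Fin 2) F) * lower l = upper y * g := by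
    rw [← hxu, hx]; simp
  have e10 := congrArg (fun h : SpecialLinearGroup (Fin 2) F => h 1 0) hcomm
  have e00 := congrArg (fun h : SpecialLinearGroup (Fin 2) F => h 0 0) hcomm
  simp only [mul_entry, upper_entries, lower_entries] at e10 e00
  have hg11 : (g : SpecialLinearGroup (Fin 2) F) 1 1 = 0 := by
    have : (g : SpecialLinearGroup (Fin 2) F) 1 1 * l = 0 := by linear_combination e10
    exact (mul_eq_zero.1 this).resolve_right hl
  have hdg := det_eq_one (g : SpecialLinearGroup (Fin 2) F)
  rw [hg11] at hdg
  linear_combination -l * hdg - (g : SpecialLinearGroup (Fin 2) F) 1 0 * e00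

section Counting

open Finset
open scoped Classical

variable [Fintype F] (G : Subgroup (SpecialLinearGroup (Fin 2) F))

/-- The elements of `upperParams G` as a finset. -/
noncomputable def upperFinset : Finset F := {x | x ∈ upperParams G}

/-- The upper triangular elements of `G`. -/
noncomputable def borel : Finset (SpecialLinearGroup (Fin 2) F) := {g | g ∈ G ∧ g 1 0 = 0}

/-- The elements of `G` that are not upper triangular. -/
noncomputable def nonBorel : Finset (SpecialLinearGroup (Fin 2) F) := {g | g ∈ G ∧ g 1 0 ≠ 0}

/-- The elements of trace `2` of `G` that are not upper triangular. -/
noncomputable def nonBorelUnipotent : Finset (SpecialLinearGroup (Fin 2) F) :=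
  {g ∈ nonBorel G | g 0 0 + g 1 1 = 2}

/-- The upper left entries of the upper triangular elements of `G`. -/
noncomputable def diagParams : Finset F := (borel G).image fun g => g 0 0

variable {G}

lemma mem_upperFinset {x : F} : x ∈ upperFinset G ↔ upper x ∈ G := by
  simp [upperFinset, mem_upperParams]

lemma mem_borel {g : SpecialLinearGroup (Fin 2) F} : g ∈ borel G ↔ g ∈ G ∧ g 1 0 = 0 := by
  simp [borel]

lemma mem_nonBorel {g : SpecialLinearGroup (Fin 2) F} :
    g ∈ nonBorel G ↔ g ∈ G ∧ g 1 0 ≠ 0 := by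
  simp [nonBorel]

lemma mem_nonBorelUnipotent {g : SpecialLinearGroup (Fin 2) F} :
    g ∈ nonBorelUnipotent G ↔ (g ∈ G ∧ g 1 0 ≠ 0) ∧ g 0 0 + g 1 1 = 2 := by
  simp [nonBorelUnipotent, mem_nonBorel]

lemma mem_diagParams {t : F} : t ∈ diagParams G ↔ ∃ g ∈ G, g 1 0 = 0 ∧ g 0 0 = t := by
  simp [diagParams, mem_borel, and_assoc]

lemma card_upperFinset : #(upperFinset G) = Nat.card (upperParams G) := by
  rw [Nat.card_eq_fintype_card, Fintype.card_subtype, upperFinset]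

lemma card_borel_le : #(borel G) ≤ #(upperFinset G) * #(diagParams G) := by
  refine card_le_mul_card_image _ _ fun t ht => ?_
  obtain ⟨g, hg, hgt⟩ := mem_image.1 ht
  obtain ⟨hgG, hg10⟩ := mem_borel.1 hg
  have hdet := det_eq_one g
  refine card_le_card_of_injOn (fun h => (g⁻¹ * h) 0 1) ?_ ?_
  · intro h hh
    obtain ⟨hh, hht⟩ := mem_filter.1 (mem_coe.1 hh)
    obtain ⟨hhG, hh10⟩ := mem_borel.1 hh
    have hdet' := det_eq_one h
    rw [mem_coe, mem_upperFinset]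
    have : upper ((g⁻¹ * h) 0 1) = g⁻¹ * h := by
      have e : g 0 0 = h 0 0 := hgt.trans hht.symm
      apply ext_entries <;> simp only [mul_entry, inv_entries, upper_entries, hg10, hh10]
      · rw [hg10] at hdet; linear_combination -hdet + g 1 1 * e
      · ring
      · rw [hh10] at hdet'; linear_combination -hdet' - h 1 1 * e
    rw [this]
    exact G.mul_mem (G.inv_mem hgG) hhG
  · intro h hh h' hh' heq
    obtain ⟨hh, hht⟩ := mem_filter.1 (mem_coe.1 hh)
    obtain ⟨hh', hht'⟩ := mem_filter.1 (mem_coe.1 hh')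
    have h1 := (mem_borel.1 hh).2
    have h2 := (mem_borel.1 hh').2
    have e : h 0 0 = h' 0 0 := hht.trans hht'.symm
    have d := det_eq_one h
    have d' := det_eq_one h'
    rw [h1] at d
    rw [h2] at d'
    have h0 : h 0 0 ≠ 0 := by rintro h0; simp [h0] at d
    have e11 : h 1 1 = h' 1 1 := mul_left_cancel₀ h0 (by rw [← e] at d'; linear_combination d - d')
    have hg11 : g 1 1 ≠ 0 := by rintro h0; simp [h0, hg10] at hdet
    simp only [mul_entry, inv_entries] at heq
    exact ext_entries e (mul_left_cancel₀ hg11 (by linear_combination heq + g 0 1 * e11))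
      (h1.trans h2.symm) e11

lemma card_nonBorel_mul_le :
    #(nonBorel G) * (#(upperFinset G) - 1) ≤ #(borel G) * #(nonBorelUnipotent G) := by
  have h0 : (0 : F) ∈ upperFinset G := by simp [mem_upperFinset, upper_zero, G.one_mem]
  rw [← card_erase_of_mem h0, ← card_product]
  refine card_le_mul_card_image_of_maps_to (f := fun z => z.1 * upper z.2 * z.1⁻¹) ?_ _ ?_
  · rintro ⟨g, x⟩ hz
    simp only [mem_product, mem_nonBorel, mem_erase, mem_upperFinset] at hz
    obtain ⟨⟨hgG, hg⟩, hx, hxG⟩ := hz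
    rw [mem_nonBorelUnipotent]
    simp only [conj_upper_entries]
    refine ⟨⟨G.mul_mem (G.mul_mem hgG hxG) (G.inv_mem hgG), by simp [hg, hx]⟩, by ring⟩
  · intro k _
    by_cases hne : ({z ∈ nonBorel G ×ˢ (upperFinset G).erase 0 |
        z.1 * upper z.2 * z.1⁻¹ = k}).Nonempty
    · obtain ⟨⟨g, x⟩, hz⟩ := hne
      simp only [mem_filter, mem_product, mem_nonBorel, mem_erase, mem_upperFinset] at hz
      obtain ⟨⟨⟨hgG, hg⟩, hx, hxG⟩, hk⟩ := hz
      refine card_le_card_of_injOn (fun z => g⁻¹ * z.1) ?_ ?_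
      · rintro ⟨g', x'⟩ hz'
        simp only [coe_filter, Set.mem_ofPred_eq, mem_product, mem_nonBorel, mem_erase,
          mem_upperFinset] at hz'
        obtain ⟨⟨⟨hgG', hg'⟩, hx', hxG'⟩, hk'⟩ := hz'
        rw [mem_coe, mem_borel]
        refine ⟨G.mul_mem (G.inv_mem hgG) hgG', ?_⟩
        have e := hk.trans hk'.symm
        have e10 := congrArg (fun h : SpecialLinearGroup (Fin 2) F => h 1 0) e
        have e00 := congrArg (fun h : SpecialLinearGroup (Fin 2) F => h 0 0) e
        simp only [conj_upper_entries] at e10 e00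
        simp only [mul_entry, inv_entries]
        have : x' * g' 1 0 * g 1 0 * (-g 1 0 * g' 0 0 + g 0 0 * g' 1 0) = 0 := by
          linear_combination -g 1 0 ^ 2 * e00 + g 0 0 * g 1 0 * e10
        simpa [hx', hg, hg'] using this
      · rintro ⟨g', x'⟩ hz' ⟨g'', x''⟩ hz'' heq
        have hgg : g' = g'' := mul_left_cancel heq
        subst hgg
        simp only [coe_filter, Set.mem_ofPred_eq, mem_product, mem_nonBorel, mem_erase,
          mem_upperFinset] at hz' hz''
        have e := mul_left_cancel (mul_right_cancel (hz'.2.trans hz''.2.symm))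
        have := congrArg (fun h : SpecialLinearGroup (Fin 2) F => h 0 1) e
        simp only [upper_entries] at this
        rw [this]
    · rw [not_nonempty_iff_eq_empty.1 hne]; simp

lemma injOn_mul_upper : Set.InjOn (fun z : SpecialLinearGroup (Fin 2) F × F => z.1 * upper z.2)
    (nonBorelUnipotent G ×ˢ upperFinset G : Finset _) := by
  rintro ⟨g, x⟩ hz ⟨g', x'⟩ hz' heq
  simp only [coe_product, Set.mem_prod, mem_coe, mem_nonBorelUnipotent] at hz hz'
  have e10 := congrArg (fun h : SpecialLinearGroup (Fin 2) F => h 1 0) heq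
  have e00 := congrArg (fun h : SpecialLinearGroup (Fin 2) F => h 0 0) heq
  have e11 := congrArg (fun h : SpecialLinearGroup (Fin 2) F => h 1 1) heq
  simp only [mul_entry, upper_entries] at e10 e00 e11
  have hx : x = x' := mul_left_cancel₀ hz.1.1.2 (by
    linear_combination e00 + e11 - hz.1.2 + hz'.1.2 - x' * e10)
  subst hx
  exact congrArg (·, x) (mul_right_cancel heq)

lemma image_mul_upper_subset :
    (nonBorelUnipotent G ×ˢ upperFinset G).image (fun z => z.1 * upper z.2) ⊆ nonBorel G := by
  intro k hk
  obtain ⟨⟨g, x⟩, hz, rfl⟩ := mem_image.1 hk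
  simp only [mem_product, mem_nonBorelUnipotent, mem_upperFinset] at hz
  rw [mem_nonBorel]
  exact ⟨G.mul_mem hz.1.1.1 hz.2, by simpa [mul_entry, upper_entries] using hz.1.1.2⟩

lemma card_nonBorelUnipotent_mul_le :
    #(nonBorelUnipotent G) * #(upperFinset G) ≤ #(nonBorel G) := by
  rw [← card_product, ← card_image_of_injOn injOn_mul_upper]
  exact card_le_card image_mul_upper_subset

lemma upperFinset_card_pos : 0 < #(upperFinset G) :=
  card_pos.2 ⟨0, by simp [mem_upperFinset, upper_zero, G.one_mem]⟩

/-- If `G` is not upper triangular, then its torus has at least `Q - 1` elements, where `Q` is the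
number of upper unipotent elements. -/
lemma card_upperFinset_sub_one_le (hne : (nonBorel G).Nonempty) :
    #(upperFinset G) - 1 ≤ #(diagParams G) := by
  have h1 := card_nonBorel_mul_le (G := G)
  have h2 := card_nonBorelUnipotent_mul_le (G := G)
  have h3 := card_borel_le (G := G)
  have hQ := upperFinset_card_pos (G := G)
  have hM := card_pos.2 hne
  generalize #(nonBorel G) = M at *
  generalize #(upperFinset G) - 1 = R at *
  refine le_of_mul_le_mul_left (a := M * #(upperFinset G)) ?_ (by positivity)
  calc M * #(upperFinset G) * R = #(upperFinset G) * (M * R) := by ring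
    _ ≤ #(upperFinset G) * (#(borel G) * #(nonBorelUnipotent G)) := by gcongr
    _ = #(borel G) * (#(nonBorelUnipotent G) * #(upperFinset G)) := by ring
    _ ≤ (#(upperFinset G) * #(diagParams G)) * M := by gcongr
    _ = _ := by ring

/-- If the torus of `G` has at most `Q - 1` elements, then every element of `G` that is not upper
triangular is an element of trace `2` times an upper unipotent one. -/
lemma exists_trace_eq_of_card_diagParams_le (hQ : 1 < #(upperFinset G))
    (hT : #(diagParams G) ≤ #(upperFinset G) - 1) {g : SpecialLinearGroup (Fin 2) F}
    (hg : g ∈ G) (hg10 : g 1 0 ≠ 0) :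
    ∃ x ∈ upperParams G, g 0 0 + g 1 1 = 2 + g 1 0 * x := by
  have hcard : #(nonBorel G) ≤ #(nonBorelUnipotent G) * #(upperFinset G) := by
    have h1 := card_nonBorel_mul_le (G := G)
    have h3 := card_borel_le (G := G)
    have hR : 0 < #(upperFinset G) - 1 := by omega
    generalize #(upperFinset G) - 1 = R at *
    refine le_of_mul_le_mul_right (a := R) ?_ hR
    calc #(nonBorel G) * R ≤ #(borel G) * #(nonBorelUnipotent G) := h1
      _ ≤ (#(upperFinset G) * R) * #(nonBorelUnipotent G) := by
        gcongr
        exact h3.trans (by gcongr)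
      _ = _ := by ring
  have himage := eq_of_subset_of_card_le (image_mul_upper_subset (G := G))
    (by rw [card_image_of_injOn injOn_mul_upper, card_product]; exact hcard)
  have hmem : g ∈ nonBorel G := mem_nonBorel.2 ⟨hg, hg10⟩
  rw [← himage, mem_image] at hmem
  obtain ⟨⟨k, x⟩, hz, rfl⟩ := hmem
  simp only [mem_product, mem_nonBorelUnipotent, mem_upperFinset] at hz
  refine ⟨x, mem_upperParams.2 hz.2, ?_⟩
  simp only [mul_entry, upper_entries]
  linear_combination hz.1.2

lemma sq_mul_mem_upperParams {t x : F} (ht : t ∈ diagParams G) (hx : x ∈ upperParams G) :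
    t ^ 2 * x ∈ upperParams G := by
  obtain ⟨g, hg, hg10, rfl⟩ := mem_diagParams.1 ht
  have : upper (g 0 0 ^ 2 * x) = g * upper x * g⁻¹ := by
    apply ext_entries <;> simp only [conj_upper_entries, upper_entries, hg10] <;> ring
  rw [mem_upperParams, this]
  exact G.mul_mem (G.mul_mem hg hx) (G.inv_mem hg)

lemma ne_zero_of_mem_diagParams {t : F} (ht : t ∈ diagParams G) : t ≠ 0 := by
  obtain ⟨g, _, hg10, rfl⟩ := mem_diagParams.1 ht
  intro h0
  have := det_eq_one g
  simp [h0, hg10] at this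

lemma div_mem_diagParams {s t : F} (hs : s ∈ diagParams G) (ht : t ∈ diagParams G) :
    s / t ∈ diagParams G := by
  have ht0 := ne_zero_of_mem_diagParams ht
  obtain ⟨g, hg, hg10, rfl⟩ := mem_diagParams.1 hs
  obtain ⟨k, hk, hk10, rfl⟩ := mem_diagParams.1 ht
  refine mem_diagParams.2 ⟨g * k⁻¹, G.mul_mem hg (G.inv_mem hk), ?_, ?_⟩
  · simp [mul_entry, inv_entries, hg10, hk10]
  · have hdet := det_eq_one k
    rw [hk10] at hdet
    simp only [mul_entry, inv_entries, hk10]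
    field_simp
    linear_combination g 0 0 * hdet

/-- The squares of the torus form at most half of the nonzero elements of `upperParams G`, if the
latter contains a nonsquare. -/
lemma two_mul_card_sq_le (h1 : (1 : F) ∈ upperParams G) {z : F} (hz : z ∈ upperParams G)
    (hzsq : ¬ IsSquare z) :
    2 * #((diagParams G).image (· ^ 2)) ≤ #(upperFinset G) - 1 := by
  set S := (diagParams G).image (· ^ 2) with hS
  have hz0 : z ≠ 0 := by rintro rfl; exact hzsq (IsSquare.zero)
  have h0 : (0 : F) ∈ upperFinset G := by simp [mem_upperFinset, upper_zero, G.one_mem]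
  have hdisj : Disjoint S (S.image (· * z)) := by
    rw [Finset.disjoint_left]
    intro a ha ha'
    simp only [hS, mem_image, exists_exists_and_eq_and] at ha ha'
    obtain ⟨s, hs, rfl⟩ := ha
    obtain ⟨t, ht, hts⟩ := ha'
    have ht0 := ne_zero_of_mem_diagParams ht
    exact hzsq ⟨s / t, by field_simp; linear_combination hts⟩
  have hsub : S ∪ S.image (· * z) ⊆ (upperFinset G).erase 0 := by
    intro a ha
    simp only [hS, mem_union, mem_image, exists_exists_and_eq_and] at ha
    rw [mem_erase, mem_upperFinset, ← mem_upperParams]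
    obtain ⟨t, ht, rfl⟩ | ⟨t, ht, rfl⟩ := ha
    · exact ⟨pow_ne_zero _ (ne_zero_of_mem_diagParams ht), by
        simpa using sq_mul_mem_upperParams ht h1⟩
    · exact ⟨mul_ne_zero (pow_ne_zero _ (ne_zero_of_mem_diagParams ht)) hz0,
        sq_mul_mem_upperParams ht hz⟩
  have := card_le_card hsub
  rw [card_union_of_disjoint hdisj, card_image_of_injective _ (mul_left_injective₀ hz0),
    card_erase_of_mem h0] at this
  omega

lemma card_diagParams_le_two_mul :
    #(diagParams G) ≤ 2 * #((diagParams G).image (· ^ 2)) := by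
  refine card_le_mul_card_image _ _ fun a ha => ?_
  obtain ⟨t, _, rfl⟩ := mem_image.1 ha
  refine (card_le_card (t := {t, -t}) fun s hs => ?_).trans card_le_two
  simpa using sq_eq_sq_iff_eq_or_eq_neg.1 (mem_filter.1 hs).2

lemma neg_one_mem_diagParams (hlt : #((diagParams G).image (· ^ 2)) < #(diagParams G)) :
    (-1 : F) ∈ diagParams G := by
  by_contra hneg
  refine hlt.ne (card_image_of_injOn fun s hs t ht hst => ?_)
  obtain h | h := sq_eq_sq_iff_eq_or_eq_neg.1 hst
  · exact h
  · have := div_mem_diagParams hs ht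
    rw [h, neg_div, div_self (ne_zero_of_mem_diagParams ht)] at this
    exact absurd this hneg

end Counting

/-- The multipliers of an additive subgroup of a field. -/
def multipliers (C : AddSubgroup F) : AddSubgroup F where
  carrier := {e | ∀ x ∈ C, e * x ∈ C}
  zero_mem' := by simp [C.zero_mem]
  add_mem' := fun {a b} ha hb x hx => by
    rw [add_mul]; exact C.add_mem (ha x hx) (hb x hx)
  neg_mem' := fun {a} ha x hx => by
    rw [neg_mul]; exact C.neg_mem (ha x hx)

lemma mem_multipliers {C : AddSubgroup F} {e : F} :
    e ∈ multipliers C ↔ ∀ x ∈ C, e * x ∈ C := Iff.rfl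

/-- An additive subgroup containing `1` with a large set of multipliers is closed under
multiplication. -/
lemma mul_mem_of_card_multipliers [Finite F] {C : AddSubgroup F} (h1 : (1 : F) ∈ C)
    (hcard : Nat.card C < 2 * Nat.card (multipliers C)) {x y : F} (hx : x ∈ C) (hy : y ∈ C) :
    x * y ∈ C := by
  have hle : multipliers C ≤ C := fun e he => by simpa using he 1 h1
  obtain ⟨k, hk⟩ := AddSubgroup.card_dvd_of_le hle
  have hC : 0 < Nat.card C := Nat.card_pos
  have hk1 : k = 1 := by
    have : k < 2 := by
      by_contra hk2
      have : 2 ≤ k := by omega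
      nlinarith
    have : k ≠ 0 := by rintro rfl; omega
    omega
  have heq : multipliers C = C := AddSubgroup.eq_of_le_of_card_ge hle (by rw [hk, hk1, mul_one])
  exact mem_multipliers.1 (heq.ge hx) y hy

open Finset in
/-- If `F` is finite of odd characteristic, and `l` is a nonsquare, then the upper unipotent
parameters of a subgroup containing `[[1, 1], [0, 1]]` and `[[1, 0], [l, 1]]` are closed under
multiplication and contain `l`. -/
lemma upperParams_of_not_isSquare [Finite F] {p : ℕ} [Fact p.Prime] [CharP F p] (hp : Odd p)
    {G : Subgroup (SpecialLinearGroup (Fin 2) F)} {l : F} (hl : ¬ IsSquare l)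
    (hup : upper 1 ∈ G) (hlow : lower l ∈ G) :
    (∀ x ∈ upperParams G, ∀ y ∈ upperParams G, x * y ∈ upperParams G) ∧ l ∈ upperParams G := by
  classical
  have := Fintype.ofFinite F
  have h1 : (1 : F) ∈ upperParams G := hup
  have hl0 : l ≠ 0 := by rintro rfl; exact hl IsSquare.zero
  obtain ⟨y, hy, c, hyc⟩ := exists_eq_neg_mul_sq (p := p) hl0 hup hlow
  have hysq : ¬ IsSquare (-y) := by
    rintro ⟨s, hs⟩
    exact hl ⟨s * c, by rw [hyc, hs]; ring⟩
  have hS := two_mul_card_sq_le h1 ((upperParams G).neg_mem hy) hysq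
  have hne : (nonBorel G).Nonempty :=
    ⟨lower l, mem_nonBorel.2 ⟨hlow, by simpa [lower_entries] using hl0⟩⟩
  have hT := card_upperFinset_sub_one_le hne
  have hTS := card_diagParams_le_two_mul (G := G)
  have hone : (1 : F) ∈ diagParams G := mem_diagParams.2 ⟨1, G.one_mem, by simp, by simp⟩
  have hSpos : 0 < #((diagParams G).image (· ^ 2)) := card_pos.2 ⟨_, mem_image_of_mem _ hone⟩
  have hneg := neg_one_mem_diagParams (G := G) (by omega)
  have hmul : ∀ x ∈ upperParams G, ∀ y ∈ upperParams G, x * y ∈ upperParams G := by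
    intro x hx y hy
    refine mul_mem_of_card_multipliers h1 ?_ hx hy
    have hsub : insert 0 ((diagParams G).image (· ^ 2)) ⊆
        ({e | e ∈ multipliers (upperParams G)} : Finset F) := by
      intro e he
      rw [mem_filter]
      refine ⟨mem_univ _, ?_⟩
      obtain rfl | he := mem_insert.1 he
      · exact zero_mem _
      · obtain ⟨t, ht, rfl⟩ := mem_image.1 he
        exact mem_multipliers.2 fun x hx => sq_mul_mem_upperParams ht hx
    have hcard := card_le_card hsub
    have h0 : (0 : F) ∉ (diagParams G).image (· ^ 2) := by
      intro h0
      obtain ⟨t, ht, ht0⟩ := mem_image.1 h0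
      exact ne_zero_of_mem_diagParams ht (pow_eq_zero_iff two_ne_zero |>.1 ht0)
    rw [card_insert_of_notMem h0] at hcard
    rw [← card_upperFinset, Nat.card_eq_fintype_card, Fintype.card_subtype]
    omega
  refine ⟨hmul, ?_⟩
  obtain ⟨g, hg, hg10, hg00⟩ := mem_diagParams.1 hneg
  have hdet := det_eq_one g
  have hg11 : g 1 1 = -1 := by
    rw [hg10, hg00] at hdet; linear_combination -hdet
  obtain ⟨k, hk⟩ := hp
  have hp0 : (2 * k + 1 : F) = 0 := by
    have := CharP.cast_eq_zero F p
    rw [hk] at this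
    exact_mod_cast this
  have hg2 : g 0 1 ∈ upperParams G := by
    have h2 : -2 * g 0 1 ∈ upperParams G := by
      have : upper (-2 * g 0 1) = g * g := by
        apply ext_entries <;> simp only [mul_entry, upper_entries, hg10, hg00, hg11] <;> ring
      rw [mem_upperParams, this]
      exact G.mul_mem hg hg
    have h3 := (upperParams G).nsmul_mem h2 k
    rw [nsmul_eq_mul] at h3
    convert h3 using 1
    linear_combination g 0 1 * hp0
  set h := g * upper (g 0 1) * lower l with hh
  have hhG : h ∈ G := G.mul_mem (G.mul_mem hg hg2) hlow
  have hh00 : h 0 0 = -1 := by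
    simp only [hh, mul_entry, upper_entries, lower_entries, hg00]; ring
  have hh11 : h 1 1 = -1 := by
    simp only [hh, mul_entry, upper_entries, lower_entries, hg10, hg11]; ring
  have hh10 : h 1 0 = -l := by
    simp only [hh, mul_entry, upper_entries, lower_entries, hg10, hg11]; ring
  obtain ⟨x, hx, hxe⟩ := exists_trace_eq_of_card_diagParams_le (by omega) (by omega) hhG
    (by simpa [hh10] using hl0)
  rw [hh00, hh11, hh10] at hxe
  have hlx : l * x = 4 := by linear_combination hxe
  have h20 : (2 : F) ≠ 0 := by
    intro h2
    rw [h2] at hp0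
    simp at hp0
  have hx0 : x ≠ 0 := by
    rintro rfl
    have : (2 : F) * 2 = 0 := by linear_combination -hlx
    simp [h20] at this
  have hpow : ∀ n : ℕ, x ^ n ∈ upperParams G := by
    intro n
    induction n with
    | zero => simpa using h1
    | succ n ih => rw [pow_succ]; exact hmul _ ih _ hx
  have hinv : x⁻¹ ∈ upperParams G := by
    have hq : 2 ≤ Fintype.card F := Fintype.one_lt_card
    have : x⁻¹ = x ^ (Fintype.card F - 2) := by
      refine inv_eq_of_mul_eq_one_right ?_
      rw [← pow_succ',
        show Fintype.card F - 2 + 1 = Fintype.card F - 1 by omega]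
      exact FiniteField.pow_card_sub_one_eq_one x hx0
    rw [this]
    exact hpow _
  have := (upperParams G).nsmul_mem hinv 4
  rw [nsmul_eq_mul] at this
  convert this using 1
  push_cast
  field_simp
  exact hlx

end DicksonSL2

/-- Dickson's theorem: for `q ≠ 9` an odd prime power or `q = 2`, and `λ` a
primitive element of `GF(q)`, the group `SL(2,q)` is generated by
`[[1,1],[0,1]]` and `[[1,0],[λ,1]]`. -/
theorem dickson_sl2_generators (F : Type*) [Field F] [Fintype F]
    (h : (Odd (Fintype.card F) ∧ Fintype.card F ≠ 9) ∨ Fintype.card F = 2)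
    (l : Fˣ) (hl : ∀ x : Fˣ, x ∈ Subgroup.zpowers l) :
    Subgroup.closure
      ({⟨!![1, 1; 0, 1], by simp [Matrix.det_fin_two_of]⟩,
        ⟨!![1, 0; (l : F), 1], by simp [Matrix.det_fin_two_of]⟩} :
        Set (Matrix.SpecialLinearGroup (Fin 2) F)) = ⊤ := by
  have hup : DicksonSL2.upper (1 : F) ∈ Subgroup.closure
      ({DicksonSL2.upper (1 : F), DicksonSL2.lower (l : F)} :
        Set (Matrix.SpecialLinearGroup (Fin 2) F)) := Subgroup.subset_closure (by simp)
  have hlow : DicksonSL2.lower (l : F) ∈ Subgroup.closure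
      ({DicksonSL2.upper (1 : F), DicksonSL2.lower (l : F)} :
        Set (Matrix.SpecialLinearGroup (Fin 2) F)) := Subgroup.subset_closure (by simp)
  change Subgroup.closure ({DicksonSL2.upper (1 : F), DicksonSL2.lower (l : F)} :
        Set (Matrix.SpecialLinearGroup (Fin 2) F)) = ⊤
  generalize Subgroup.closure ({DicksonSL2.upper (1 : F), DicksonSL2.lower (l : F)} :
        Set (Matrix.SpecialLinearGroup (Fin 2) F)) = G at hup hlow ⊢
  refine DicksonSL2.eq_top_of_forall_upper_mem l.ne_zero hlow fun x => ?_
  rw [← DicksonSL2.mem_upperParams]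
  by_cases hx : x = 0
  · rw [hx]; exact zero_mem _
  obtain ⟨hodd, -⟩ | h2 := h
  · obtain ⟨p, hchar⟩ := CharP.exists F
    obtain ⟨n, hp, hcard⟩ := FiniteField.card F p
    have : Fact p.Prime := ⟨hp⟩
    have hpodd : Odd p := by
      rw [hcard] at hodd
      exact (Nat.odd_pow_iff n.ne_zero).1 hodd
    have hsq : ¬ IsSquare (l : F) := by
      rintro ⟨s, hs⟩
      have hs0 : s ≠ 0 := by rintro rfl; simp at hs
      have hgen : orderOf l = Fintype.card F - 1 := by
        classical
        rw [orderOf_eq_card_of_forall_mem_zpowers hl, Nat.card_eq_fintype_card,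
          Fintype.card_units]
      have hF : 1 < Fintype.card F := Fintype.one_lt_card
      obtain ⟨k, hk⟩ := hodd
      have hlk : l ^ k = 1 := by
        ext
        rw [Units.val_pow_eq_pow_val, hs, ← pow_two, ← pow_mul,
          show 2 * k = Fintype.card F - 1 by omega]
        exact FiniteField.pow_card_sub_one_eq_one s hs0
      have := Nat.le_of_dvd (by omega) (orderOf_dvd_of_pow_eq_one hlk)
      omega
    obtain ⟨hmul, hlmem⟩ := DicksonSL2.upperParams_of_not_isSquare hpodd hsq hup hlow
    obtain ⟨n, hn⟩ := mem_powers_iff_mem_zpowers.2 (hl (Units.mk0 x hx))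
    have hxn : x = (l : F) ^ n := by
      simpa using (congrArg Units.val hn).symm
    rw [hxn]
    clear hn hxn
    induction n with
    | zero => simpa using DicksonSL2.mem_upperParams.2 hup
    | succ n ih => rw [pow_succ]; exact hmul _ ih _ hlmem
  · have hx1 : x = 1 := by
      have := FiniteField.pow_card_sub_one_eq_one x hx
      simpa [h2] using this
    rw [hx1]
    exact hup
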